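/- arXiv:math/0601149 — 5 statements merged into one kernel-verified Lean document; each statement's English description precedes it below -/
import Mathlib

section
/- Let n be a positive natural number, let f : ℝ → ℝ be infinitely differentiable, and let y : (Fin n → ℝ) → ℝ be infinitely differentiable. Then for every point x, the mixed partial derivative ∂ⁿ(f ∘ y)/∂x₁ ∂x₂ ⋯ ∂xₙ evaluated at x (i.e., the iterated directional derivative of f ∘ y along the standard basis vectors e₁, …, eₙ, taken once each) equals the sum, over all partitions π of the finite set {1, …, n}, of f^(|π|)(y(x)) times the product over the blocks B of π of the mixed partial derivative ∂^{|B|} y / ∏_{j ∈ B} ∂x_j evaluated at x, where |π| denotes the number of blocks of π and |B| the size of the block B. -/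
/-- Iterated directional (line) derivative along a list of direction vectors. -/
noncomputable def iterLineDeriv {E : Type*} [NormedAddCommGroup E] [NormedSpace ℝ E] :
    List E → (E → ℝ) → E → ℝ
  | [], g => g
  | v :: vs, g => fun x => lineDeriv ℝ (iterLineDeriv vs g) x v

section IterLineDeriv

variable {E : Type*} [NormedAddCommGroup E] [NormedSpace ℝ E]

theorem ContDiff.lineDeriv_eq_fderiv {g : E → ℝ} (hg : ContDiff ℝ (⊤ : ℕ∞) g) (v : E) :
    (fun x => lineDeriv ℝ g x v) = fun x => fderiv ℝ g x v :=
  funext fun x => ((hg.differentiable (by simp)) x).lineDeriv_eq_fderiv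

theorem ContDiff.lineDeriv_const {g : E → ℝ} (hg : ContDiff ℝ (⊤ : ℕ∞) g) (v : E) :
    ContDiff ℝ (⊤ : ℕ∞) fun x => lineDeriv ℝ g x v := by
  rw [hg.lineDeriv_eq_fderiv v]
  exact (hg.fderiv_right (m := (⊤ : ℕ∞)) (by simp)).clm_apply contDiff_const

theorem ContDiff.iterLineDeriv {g : E → ℝ} (hg : ContDiff ℝ (⊤ : ℕ∞) g) :
    ∀ l : List E, ContDiff ℝ (⊤ : ℕ∞) (iterLineDeriv l g)
  | [] => hg
  | v :: l => (hg.iterLineDeriv l).lineDeriv_const v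

theorem ContDiff.lineDeriv_comm {g : E → ℝ} (hg : ContDiff ℝ (⊤ : ℕ∞) g) (v w : E) (x : E) :
    lineDeriv ℝ (fun z => lineDeriv ℝ g z v) x w =
      lineDeriv ℝ (fun z => lineDeriv ℝ g z w) x v := by
  have key (u u' : E) : lineDeriv ℝ (fun z => lineDeriv ℝ g z u) x u' =
      fderiv ℝ (fderiv ℝ g) x u' u := by
    have hd : DifferentiableAt ℝ (fderiv ℝ g) x :=
      ((hg.fderiv_right (m := (⊤ : ℕ∞)) (by simp)).differentiable (by simp)) x
    rw [((hg.lineDeriv_const u).differentiable (by simp) x).lineDeriv_eq_fderiv,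
      hg.lineDeriv_eq_fderiv, fderiv_clm_apply hd (differentiableAt_const u)]
    simp
  rw [key, key]
  exact hg.contDiffAt.isSymmSndFDerivAt (by simpa using WithTop.coe_le_coe.2 (le_top (a := (2 : ℕ∞)))) w v

theorem ContDiff.iterLineDeriv_perm {g : E → ℝ} (hg : ContDiff ℝ (⊤ : ℕ∞) g) {l l' : List E}
    (h : l.Perm l') : _root_.iterLineDeriv l g = _root_.iterLineDeriv l' g := by
  induction h with
  | nil => rfl
  | cons v _ ih => simp only [_root_.iterLineDeriv, ih]
  | swap v w l => exact funext ((hg.iterLineDeriv l).lineDeriv_comm v w)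
  | trans _ _ ih ih' => exact ih.trans ih'

theorem ContDiff.iterLineDeriv_toList_insert {ι : Type*} [DecidableEq ι] {g : E → ℝ}
    (hg : ContDiff ℝ (⊤ : ℕ∞) g) (v : ι → E) {s : Finset ι} {a : ι} (ha : a ∉ s) :
    _root_.iterLineDeriv ((insert a s).toList.map v) g =
      fun x => lineDeriv ℝ (_root_.iterLineDeriv (s.toList.map v) g) x (v a) :=
  hg.iterLineDeriv_perm ((Finset.toList_insert ha).map v)

end IterLineDeriv

namespace Finpartition

variable {ι : Type*} [DecidableEq ι] {s : Finset ι} {a : ι}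

/-- The partition of `insert a s` obtained by adding `a` to the block `C` of a partition of `s`, or
as a new singleton block if `C = ∅`. -/
def insertInto (P : Finpartition s) (ha : a ∉ s) (C : Finset ι) (hC : C ∈ insert ∅ P.parts) :
    Finpartition (insert a s) :=
  ofExistsUnique (insert (insert a C) (P.parts.erase C))
    (by
      intro p hp
      have hCs : C ⊆ s := by
        rcases Finset.mem_insert.1 hC with rfl | h
        exacts [Finset.empty_subset _, P.subset h]
      rcases Finset.mem_insert.1 hp with rfl | h
      · exact Finset.insert_subset_insert a hCs
      · exact (P.subset (Finset.mem_of_mem_erase h)).trans (Finset.subset_insert a s))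
    (by
      intro b hb
      rcases Finset.mem_insert.1 hb with rfl | hbs
      · refine ⟨insert b C, by simp, ?_⟩
        rintro t ⟨ht, hbt⟩
        rcases Finset.mem_insert.1 ht with rfl | h
        · rfl
        · exact absurd (P.subset (Finset.mem_of_mem_erase h) hbt) ha
      · have hba : b ≠ a := by rintro rfl; exact ha hbs
        obtain ⟨t, ⟨ht, hbt⟩, hu⟩ := P.existsUnique_mem hbs
        by_cases hbC : b ∈ C
        · refine ⟨insert a C, by simp [hbC], ?_⟩
          rintro u ⟨hu', hbu⟩
          rcases Finset.mem_insert.1 hu' with rfl | h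
          · rfl
          · have hCP : C ∈ P.parts := by
              rcases Finset.mem_insert.1 hC with rfl | h'
              · simp at hbC
              · exact h'
            exact absurd (P.eq_of_mem_parts (Finset.mem_of_mem_erase h) hCP hbu hbC)
              (Finset.ne_of_mem_erase h)
        · refine ⟨t, ⟨Finset.mem_insert_of_mem (Finset.mem_erase.2 ⟨?_, ht⟩), hbt⟩, ?_⟩
          · rintro rfl; exact hbC hbt
          · rintro u ⟨hu', hbu⟩
            rcases Finset.mem_insert.1 hu' with rfl | h
            · simp [hba, hbC] at hbu
            · exact hu u ⟨Finset.mem_of_mem_erase h, hbu⟩)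
    (by
      rw [Finset.mem_insert, not_or]
      exact ⟨(Finset.insert_ne_empty a C).symm,
        fun h => P.empty_notMem_parts (Finset.mem_of_mem_erase h)⟩)

theorem parts_insertInto (P : Finpartition s) (ha : a ∉ s) (C : Finset ι)
    (hC : C ∈ insert ∅ P.parts) :
    (P.insertInto ha C hC).parts = insert (insert a C) (P.parts.erase C) := rfl

theorem notMem_of_mem_insert_empty_parts (P : Finpartition s) (ha : a ∉ s) {C : Finset ι}
    (hC : C ∈ insert ∅ P.parts) : a ∉ C := by
  rcases Finset.mem_insert.1 hC with rfl | h
  exacts [Finset.notMem_empty a, fun h' => ha (P.subset h h')]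

theorem insert_notMem_erase_parts (P : Finpartition s) (ha : a ∉ s) (C : Finset ι) :
    insert a C ∉ P.parts.erase C := fun h =>
  ha (P.subset (Finset.mem_of_mem_erase h) (Finset.mem_insert_self a C))

theorem part_insertInto (P : Finpartition s) (ha : a ∉ s) {C : Finset ι}
    (hC : C ∈ insert ∅ P.parts) : (P.insertInto ha C hC).part a = insert a C :=
  part_eq_of_mem _ (by simp [parts_insertInto]) (by simp)

theorem insertInto_injective {P Q : Finpartition s} (ha : a ∉ s) {C D : Finset ι}
    (hC : C ∈ insert ∅ P.parts) (hD : D ∈ insert ∅ Q.parts)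
    (h : P.insertInto ha C hC = Q.insertInto ha D hD) : P = Q ∧ C = D := by
  have hCD : C = D := by
    have := part_insertInto P ha hC
    rw [h, part_insertInto] at this
    rw [← Finset.erase_insert (P.notMem_of_mem_insert_empty_parts ha hC), ← this,
      Finset.erase_insert (Q.notMem_of_mem_insert_empty_parts ha hD)]
  subst hCD
  refine ⟨?_, rfl⟩
  have he : P.parts.erase C = Q.parts.erase C := by
    have := congrArg (fun R => R.parts.erase (insert a C)) h
    simpa only [parts_insertInto, Finset.erase_insert (insert_notMem_erase_parts _ ha C)] using this
  ext1
  rcases C.eq_empty_or_nonempty with rfl | hne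
  · simpa [Finset.erase_eq_of_notMem, P.empty_notMem_parts, Q.empty_notMem_parts] using he
  · rw [← Finset.insert_erase (Finset.mem_of_mem_insert_of_ne hC hne.ne_empty), he,
      Finset.insert_erase (Finset.mem_of_mem_insert_of_ne hD hne.ne_empty)]

theorem exists_insertInto_eq (ha : a ∉ s) (Q : Finpartition (insert a s)) :
    ∃ (P : Finpartition s) (C : Finset ι) (hC : C ∈ insert ∅ P.parts),
      P.insertInto ha C hC = Q := by
  have haQ : a ∈ Q.part a := Q.mem_part_self.2 (Finset.mem_insert_self a s)
  have hpQ : Q.part a ∈ Q.parts := Q.part_mem.2 (Finset.mem_insert_self a s)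
  have hmem (t : Finset ι) : t ∈ (Q.avoid {a}).parts ↔
      (t ∈ Q.parts ∧ t ≠ Q.part a) ∨ (t = (Q.part a).erase a ∧ t ≠ ∅) := by
    rw [mem_avoid]
    constructor
    · rintro ⟨d, hd, hda, rfl⟩
      by_cases had : a ∈ d
      · obtain rfl := Q.part_eq_of_mem hd had
        refine Or.inr ⟨Finset.sdiff_singleton_eq_erase _ _, ?_⟩
        rwa [Ne, Finset.sdiff_eq_empty_iff_subset]
      · rw [Finset.sdiff_singleton_eq_erase, Finset.erase_eq_of_notMem had]
        exact Or.inl ⟨hd, fun h => had (h ▸ haQ)⟩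
    · rintro (⟨ht, hne⟩ | ⟨rfl, hne⟩)
      · have hat : a ∉ t := fun h => hne (Q.part_eq_of_mem ht h).symm
        refine ⟨t, ht, fun h => ?_, by
          rw [Finset.sdiff_singleton_eq_erase, Finset.erase_eq_of_notMem hat]⟩
        obtain ⟨b, hb⟩ := Q.nonempty_of_mem_parts ht
        exact hat (Finset.mem_singleton.1 (h hb) ▸ hb)
      · refine ⟨Q.part a, hpQ, fun h => hne ?_, Finset.sdiff_singleton_eq_erase _ _⟩
        rw [← Finset.sdiff_singleton_eq_erase]
        exact Finset.sdiff_eq_empty_iff_subset.2 h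
  have hs : insert a s \ {a} = s := by
    rw [Finset.sdiff_singleton_eq_erase, Finset.erase_insert ha]
  refine ⟨(Q.avoid {a}).copy hs, (Q.part a).erase a, ?_, ?_⟩
  · change _ ∈ insert ∅ (Q.avoid {a}).parts
    rw [Finset.mem_insert, hmem]
    tauto
  · ext1
    rw [parts_insertInto, Finset.insert_erase haQ]
    ext t
    change t ∈ insert _ ((Q.avoid {a}).parts.erase _) ↔ _
    rw [Finset.mem_insert, Finset.mem_erase, hmem]
    constructor
    · rintro (rfl | h)
      · exact hpQ
      · tauto
    · intro ht
      by_cases htp : t = Q.part a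
      · exact Or.inl htp
      · refine Or.inr ⟨?_, Or.inl ⟨ht, htp⟩⟩
        rintro rfl
        obtain ⟨b, hb⟩ := Q.nonempty_of_mem_parts ht
        exact htp (Q.eq_of_mem_parts ht hpQ hb (Finset.mem_of_mem_erase hb))

theorem sum_insert {M : Type*} [AddCommMonoid M] (ha : a ∉ s) (F : Finset (Finset ι) → M) :
    ∑ Q : Finpartition (insert a s), F Q.parts =
      ∑ P : Finpartition s, ∑ C ∈ insert ∅ P.parts,
        F (insert (insert a C) (P.parts.erase C)) := by
  rw [Finset.sum_sigma']
  symm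
  refine Finset.sum_bij
    (fun p hp => p.1.insertInto ha p.2 (Finset.mem_sigma.1 hp).2) (by simp) ?_ ?_
    (fun _ _ => rfl)
  · rintro ⟨P, C⟩ hp ⟨Q, D⟩ hq h
    obtain ⟨rfl, rfl⟩ := insertInto_injective ha _ _ h
    rfl
  · intro Q _
    obtain ⟨P, C, hC, h⟩ := exists_insertInto_eq ha Q
    exact ⟨⟨P, C⟩, by simpa using hC, h⟩

end Finpartition

theorem hasLineDerivAt_iteratedDeriv_mul_prod {E ι : Type*} [NormedAddCommGroup E]
    [NormedSpace ℝ E] [DecidableEq ι] {f : ℝ → ℝ} (hf : ContDiff ℝ (⊤ : ℕ∞) f) {y : E → ℝ}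
    (hy : ContDiff ℝ (⊤ : ℕ∞) y) (v : ι → E) {s : Finset ι} {a : ι} (ha : a ∉ s)
    (P : Finpartition s) (x : E) :
    HasLineDerivAt ℝ
      (fun z => iteratedDeriv P.parts.card f (y z) *
        ∏ B ∈ P.parts, iterLineDeriv (B.toList.map v) y z)
      (∑ C ∈ insert ∅ P.parts,
        iteratedDeriv (insert (insert a C) (P.parts.erase C)).card f (y x) *
          ∏ B ∈ insert (insert a C) (P.parts.erase C), iterLineDeriv (B.toList.map v) y x)
      x (v a) := by
  have hline {g : E → ℝ} (hg : ContDiff ℝ (⊤ : ℕ∞) g) :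
      HasDerivAt (fun t : ℝ => g (x + t • v a)) (lineDeriv ℝ g x (v a)) 0 :=
    ((hg.differentiable (by simp)) x).lineDifferentiableAt.hasLineDerivAt
  have hD : HasDerivAt (iteratedDeriv P.parts.card f)
      (iteratedDeriv (P.parts.card + 1) f (y x)) (y (x + (0 : ℝ) • v a)) := by
    rw [zero_smul, add_zero, iteratedDeriv_succ]
    exact ((hf.differentiable_iteratedDeriv _ (by exact_mod_cast ENat.natCast_lt_top _)) _).hasDerivAt
  have hprod := HasDerivAt.fun_finsetProd (u := P.parts)
    fun B _ => hline (hy.iterLineDeriv (B.toList.map v))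
  have h := (hD.comp (0 : ℝ) (hline hy)).mul hprod
  refine HasDerivAt.congr_deriv h ?_
  rw [Finset.sum_insert P.empty_notMem_parts, Finset.erase_eq_of_notMem P.empty_notMem_parts]
  simp only [zero_smul, add_zero, Function.comp_apply, smul_eq_mul]
  congr 1
  · have hn : insert a ∅ ∉ P.parts := fun h => ha (P.subset h (by simp))
    rw [Finset.card_insert_of_notMem hn, Finset.prod_insert hn,
      hy.iterLineDeriv_toList_insert v (Finset.notMem_empty a)]
    simp only [Finset.toList_empty, List.map_nil, iterLineDeriv]
    ring
  · rw [Finset.mul_sum]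
    refine Finset.sum_congr rfl fun C hC => ?_
    have hn := P.insert_notMem_erase_parts ha C
    rw [Finset.card_insert_of_notMem hn, Finset.card_erase_add_one hC, Finset.prod_insert hn,
      hy.iterLineDeriv_toList_insert v fun h => ha (P.subset hC h)]
    ring

theorem iterLineDeriv_comp_eq_sum_finpartition {E ι : Type*} [NormedAddCommGroup E]
    [NormedSpace ℝ E] [DecidableEq ι] {f : ℝ → ℝ} (hf : ContDiff ℝ (⊤ : ℕ∞) f) {y : E → ℝ}
    (hy : ContDiff ℝ (⊤ : ℕ∞) y) (v : ι → E) (s : Finset ι) (x : E) :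
    iterLineDeriv (s.toList.map v) (f ∘ y) x =
      ∑ P : Finpartition s, iteratedDeriv P.parts.card f (y x) *
        ∏ B ∈ P.parts, iterLineDeriv (B.toList.map v) y x := by
  induction s using Finset.induction_on generalizing x with
  | empty =>
    rw [← Finset.bot_eq_empty, Fintype.sum_unique, Finpartition.parts_eq_empty_iff.2 rfl]
    simp [iterLineDeriv]
  | insert a s ha ih =>
    rw [(hf.comp hy).iterLineDeriv_toList_insert v ha, funext ih,
      Finpartition.sum_insert ha fun R => iteratedDeriv R.card f (y x) *
        ∏ B ∈ R, iterLineDeriv (B.toList.map v) y x]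
    exact (HasDerivAt.fun_sum fun P _ =>
      hasLineDerivAt_iteratedDeriv_mul_prod hf hy v ha P x).deriv

/-- Faà di Bruno's formula in its "all variables distinct" form: the mixed partial
derivative `∂ⁿ (f ∘ y) / ∂x₁ ⋯ ∂xₙ` is the sum over all partitions `π` of `{1, …, n}`
of `f^(|π|)(y x)` times the product over blocks `B` of `π` of
`∂^{|B|} y / ∏_{j ∈ B} ∂x_j`. -/
theorem mixed_partial_comp_eq_sum_finpartitions (n : ℕ) (hn : 0 < n)
    (f : ℝ → ℝ) (hf : ContDiff ℝ (⊤ : ℕ∞) f)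
    (y : (Fin n → ℝ) → ℝ) (hy : ContDiff ℝ (⊤ : ℕ∞) y) (x : Fin n → ℝ) :
    iterLineDeriv ((List.finRange n).map fun j => Pi.single j (1 : ℝ)) (f ∘ y) x =
      ∑ π : Finpartition (Finset.univ : Finset (Fin n)),
        iteratedDeriv π.parts.card f (y x) *
          ∏ B ∈ π.parts,
            iterLineDeriv (B.toList.map fun j => Pi.single j (1 : ℝ)) y x := by
  rw [(hf.comp hy).iterLineDeriv_perm (l' := (Finset.univ : Finset (Fin n)).toList.map _)
    (List.Perm.map _ ?_)]
  · exact iterLineDeriv_comp_eq_sum_finpartition hf hy _ _ x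
  · rw [List.perm_ext_iff_of_nodup (List.nodup_finRange n) (Finset.nodup_toList _)]
    simp
end

section
/- Let n be a positive natural number, k₁, …, kₙ positive natural numbers with N = k₁ + ⋯ + kₙ, and let τ be the multiset over {1, …, n} containing each i with multiplicity kᵢ. Let c : {1, …, N} → {1, …, n} be any map whose fiber over i has size kᵢ for each i. Consider a partition of the multiset τ written as m₁τ₁ + m₂τ₂ + ⋯ + m_sτ_s, where τ₁, …, τ_s are pairwise distinct nonempty multisets over {1, …, n}, each occurring with multiplicity mᵢ ≥ 1, and m₁τ₁ + ⋯ + m_sτ_s = τ as multisets. Then the number of partitions π of the set {1, …, N} whose collapse under c (i.e., the multiset of multisets obtained by replacing each block B of π by its multiset image c(B)) equals this multiset partition is exactly (k₁! ⋯ kₙ!) / (τ₁!!^{m₁} τ₂!!^{m₂} ⋯ τ_s!!^{m_s} · m₁! m₂! ⋯ m_s!), where σ!! denotes the product of the factorials of the multiplicities of the members of the multiset σ. -/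
/-- `σ!!`: the product of the factorials of the multiplicities of the members of the
multiset `σ`.  For example `{1,1,1,1,2,2,2}!! = 4! * 3!`. -/
def multisetFactorial {α : Type*} [DecidableEq α] (σ : Multiset α) : ℕ :=
  ∏ a ∈ σ.toFinset, (σ.count a).factorial

/-- The collapse of a set partition `π` of `{1, …, N}` along a map `c : Fin N → Fin n`:
the multiset of the multiset-images `c(B)` of the blocks `B` of `π`. -/
def collapsePartition {N n : ℕ} (c : Fin N → Fin n)
    (π : Finpartition (Finset.univ : Finset (Fin N))) : Multiset (Multiset (Fin n)) :=
  π.parts.val.map fun B => B.val.map c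

theorem multisetFactorial_eq_prod {α : Type*} [DecidableEq α] {σ : Multiset α} {s : Finset α}
    (h : σ.toFinset ⊆ s) : multisetFactorial σ = ∏ a ∈ s, (σ.count a).factorial := by
  refine Finset.prod_subset h fun a _ ha => ?_
  rw [Multiset.count_eq_zero_of_notMem (by simpa using ha), Nat.factorial_zero]

theorem multisetFactorial_pos {α : Type*} [DecidableEq α] (σ : Multiset α) :
    0 < multisetFactorial σ :=
  Finset.prod_pos fun _ _ => Nat.factorial_pos _

theorem multisetFactorial_cons {α : Type*} [DecidableEq α] (a : α) (σ : Multiset α) :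
    multisetFactorial (a ::ₘ σ) = multisetFactorial σ * (σ.count a + 1) := by
  have ha : a ∈ (a ::ₘ σ).toFinset := by simp
  rw [multisetFactorial_eq_prod (σ := σ) (s := (a ::ₘ σ).toFinset)
    (Multiset.toFinset_subset.2 (Multiset.subset_cons σ a)), multisetFactorial,
    ← Finset.mul_prod_erase _ _ ha, ← Finset.mul_prod_erase _ _ ha, Multiset.count_cons_self,
    Nat.factorial_succ, Finset.prod_congr rfl fun b hb => by
      rw [Multiset.count_cons_of_ne (Finset.ne_of_mem_erase hb)]]
  ring

theorem Multiset.powerset_map_eq {α β : Type*} (f : α → β) (s : Multiset α) :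
    (s.map f).powerset = s.powerset.map (Multiset.map f) := by
  induction s using Multiset.induction_on with
  | empty => simp
  | cons a s ih => simp [Multiset.powerset_cons, ih, Multiset.map_map]

theorem count_powerset_mul_multisetFactorial {α : Type*} [DecidableEq α] (s : Multiset α) :
    ∀ t ≤ s, s.powerset.count t * (multisetFactorial t * multisetFactorial (s - t)) =
      multisetFactorial s := by
  induction s using Multiset.induction_on with
  | empty =>
    intro t ht
    obtain rfl : t = 0 := by simpa using ht
    simp [multisetFactorial]
  | cons a s ih =>
    intro t ht
    rw [Multiset.powerset_cons, Multiset.count_add, multisetFactorial_cons]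
    by_cases hat : a ∈ t
    · obtain ⟨u, rfl⟩ := Multiset.exists_cons_of_mem hat
      have hu : u ≤ s := (Multiset.cons_le_cons_iff a).1 ht
      rw [Multiset.count_map_eq_count' _ _ fun _ _ h => by simpa using h,
        Multiset.sub_cons, Multiset.erase_cons_head, multisetFactorial_cons]
      have h₂ := ih u hu
      by_cases hs : a ::ₘ u ≤ s
      · have h₁ := ih _ hs
        have hsu : s - u = a ::ₘ (s - a ::ₘ u) := by
          rw [← Multiset.cons_sub_of_le a hs, Multiset.sub_cons, Multiset.erase_cons_head]
        have hc : (s - a ::ₘ u).count a + 1 + u.count a = s.count a := by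
          have := Multiset.count_le_of_le a hs
          simp only [Multiset.count_sub, Multiset.count_cons_self] at this ⊢
          omega
        rw [multisetFactorial_cons] at h₁
        have e : multisetFactorial (s - u) =
            multisetFactorial (s - a ::ₘ u) * ((s - a ::ₘ u).count a + 1) := by
          rw [← multisetFactorial_cons, ← hsu]
        calc _ = s.powerset.count (a ::ₘ u) * (multisetFactorial u * (u.count a + 1) *
                  multisetFactorial (s - a ::ₘ u)) * ((s - a ::ₘ u).count a + 1) +
                s.powerset.count u * (multisetFactorial u * multisetFactorial (s - u)) *
                  (u.count a + 1) := by rw [e]; ring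
          _ = _ := by rw [h₁, h₂, ← hc]; ring
      · have hc : s.count a = u.count a := by
          refine le_antisymm ?_ (Multiset.count_le_of_le a hu)
          by_contra! h
          refine hs (Multiset.le_iff_count.2 fun b => ?_)
          rcases eq_or_ne b a with rfl | hb
          · simpa using h
          · simpa [hb] using Multiset.count_le_of_le b hu
        rw [Multiset.count_eq_zero_of_notMem (by simpa using hs), hc, ← h₂]
        ring
    · have hts : t ≤ s := (Multiset.le_cons_of_notMem hat).1 ht
      have h0 : (s.powerset.map (Multiset.cons a)).count t = 0 := by
        refine Multiset.count_eq_zero_of_notMem fun h => ?_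
        obtain ⟨u, -, rfl⟩ := Multiset.mem_map.1 h
        exact hat (Multiset.mem_cons_self a u)
      rw [h0, Multiset.cons_sub_of_le a hts, multisetFactorial_cons, ← ih t hts,
        Multiset.count_sub, Multiset.count_eq_zero_of_notMem hat]
      simp only [add_zero, tsub_zero]
      ring

theorem card_filter_powerset_map {α β : Type*} [DecidableEq β] (c : α → β) (S : Finset α)
    (t : Multiset β) :
    (S.powerset.filter fun B => B.val.map c = t).card = (S.val.map c).powerset.count t := by
  have h : S.powerset.val.map Finset.val = S.val.powerset := by
    simp [Finset.powerset, Multiset.map_pmap, Multiset.pmap_eq_map]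
  rw [Multiset.powerset_map_eq, ← h, Multiset.map_map, Multiset.count_map, Finset.card_def,
    Finset.filter_val]
  simp [eq_comm]

open Classical in
/-- The set partitions of `S` whose collapse along `c` is `M`, as finsets of blocks. The condition
on the sum says that the blocks are disjoint with union `S`; a block can only be empty if
`0 ∈ M`. -/
noncomputable def collapsingPartitions {α β : Type*} [Fintype α] (c : α → β) (S : Finset α)
    (M : Multiset (Multiset β)) : Finset (Finset (Finset α)) :=
  Finset.univ.filter fun P => ∑ B ∈ P, B.val = S.val ∧ P.val.map (fun B => B.val.map c) = M

theorem mem_collapsingPartitions {α β : Type*} [Fintype α] {c : α → β} {S : Finset α}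
    {M : Multiset (Multiset β)} {P : Finset (Finset α)} :
    P ∈ collapsingPartitions c S M ↔
      ∑ B ∈ P, B.val = S.val ∧ P.val.map (fun B => B.val.map c) = M := by
  simp [collapsingPartitions]

theorem card_collapsingPartitions_filter_mem {α β : Type*} [Fintype α] [DecidableEq α]
    [DecidableEq β] {c : α → β} {S B : Finset α} {M : Multiset (Multiset β)} {t : Multiset β}
    (ht : t ≠ 0) (hBS : B ⊆ S) (hB : B.val.map c = t) :
    ((collapsingPartitions c S (t ::ₘ M)).filter (B ∈ ·)).card =
      (collapsingPartitions c (S \ B) M).card := by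
  have hne : B.Nonempty := by
    rw [Finset.nonempty_iff_ne_empty]
    rintro rfl
    exact ht (by simpa using hB.symm)
  have hnot : ∀ P ∈ collapsingPartitions c (S \ B) M, B ∉ P := fun P hP hBP => by
    obtain ⟨b, hb⟩ := hne
    have : B.val ≤ (S \ B).val := (mem_collapsingPartitions.1 hP).1 ▸
      Finset.single_le_sum (f := Finset.val) (fun _ _ => Multiset.zero_le _) hBP
    have := Multiset.mem_of_le this hb
    exact (Finset.mem_sdiff.1 this).2 hb
  refine Finset.card_bij' (fun P _ => P.erase B) (fun P _ => insert B P) ?_ ?_ ?_ ?_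
  · intro P hP
    obtain ⟨hP, hBP⟩ := Finset.mem_filter.1 hP
    obtain ⟨h₁, h₂⟩ := mem_collapsingPartitions.1 hP
    refine mem_collapsingPartitions.2 ⟨?_, ?_⟩
    · rw [Finset.sdiff_val, ← h₁, ← Finset.add_sum_erase _ _ hBP, add_tsub_cancel_left]
    · rw [← Finset.insert_erase hBP, Finset.insert_val_of_notMem (Finset.notMem_erase _ _),
        Multiset.map_cons, hB] at h₂
      exact (Multiset.cons_inj_right t).1 h₂
  · intro P hP
    have hBP := hnot P hP
    obtain ⟨h₁, h₂⟩ := mem_collapsingPartitions.1 hP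
    refine Finset.mem_filter.2 ⟨mem_collapsingPartitions.2 ⟨?_, ?_⟩, Finset.mem_insert_self _ _⟩
    · rw [Finset.sum_insert hBP, h₁, Finset.sdiff_val,
        add_tsub_cancel_of_le (Finset.val_le_iff.2 hBS)]
    · rw [Finset.insert_val_of_notMem hBP, Multiset.map_cons, hB, h₂]
  · exact fun P hP => Finset.insert_erase (Finset.mem_filter.1 hP).2
  · exact fun P hP => Finset.erase_insert (hnot P hP)

theorem card_collapsingPartitions_cons {α β : Type*} [Fintype α] [DecidableEq α] [DecidableEq β]
    (c : α → β) (S : Finset α) (M : Multiset (Multiset β)) {t : Multiset β} (ht : t ≠ 0) :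
    (collapsingPartitions c S (t ::ₘ M)).card * (M.count t + 1) =
      ∑ B ∈ S.powerset.filter fun B => B.val.map c = t,
        (collapsingPartitions c (S \ B) M).card := by
  have hfib : ∀ P ∈ collapsingPartitions c S (t ::ₘ M),
      ((S.powerset.filter fun B => B.val.map c = t).filter (· ∈ P)).card = M.count t + 1 := by
    intro P hP
    obtain ⟨h₁, h₂⟩ := mem_collapsingPartitions.1 hP
    have hfilter : (S.powerset.filter fun B => B.val.map c = t).filter (· ∈ P) =
        P.filter fun B => t = B.val.map c := by
      ext B
      have : B ∈ P → B ⊆ S := fun hB => Finset.val_le_iff.1 (h₁ ▸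
        Finset.single_le_sum (f := Finset.val) (fun _ _ => Multiset.zero_le _) hB)
      simp only [Finset.mem_filter, Finset.mem_powerset, eq_comm (a := t)]
      tauto
    rw [hfilter, Finset.card_def, Finset.filter_val, ← Multiset.count_map, h₂,
      Multiset.count_cons_self]
  rw [← smul_eq_mul, ← Finset.sum_const, ← Finset.sum_congr rfl hfib]
  simp only [Finset.card_filter _ (Finset.filter _ _)]
  rw [Finset.sum_comm]
  refine Finset.sum_congr rfl fun B hB => ?_
  obtain ⟨hBS, hBt⟩ := Finset.mem_filter.1 hB
  rw [← Finset.card_filter,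
    card_collapsingPartitions_filter_mem ht (Finset.mem_powerset.1 hBS) hBt]

theorem card_collapsingPartitions_mul {α β : Type*} [Fintype α] [DecidableEq α] [DecidableEq β]
    (c : α → β) (M : Multiset (Multiset β)) :
    ∀ S : Finset α, 0 ∉ M → M.sum = S.val.map c →
      (collapsingPartitions c S M).card *
        ((M.map multisetFactorial).prod * multisetFactorial M) =
        multisetFactorial (S.val.map c) := by
  induction M using Multiset.induction_on with
  | empty =>
    intro S _ hS
    obtain rfl : S = ∅ := by simpa [eq_comm] using hS
    have : collapsingPartitions c ∅ 0 = {∅} := by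
      ext P
      simp +contextual [mem_collapsingPartitions]
    simp [this, multisetFactorial]
  | cons t M ih =>
    intro S h0 hS
    obtain ⟨ht, h0⟩ : 0 ≠ t ∧ 0 ∉ M := by simpa using h0
    rw [Multiset.sum_cons] at hS
    have hrec := card_collapsingPartitions_cons c S M ht.symm
    have hsub : ∀ B ∈ S.powerset.filter fun B => B.val.map c = t,
        (collapsingPartitions c (S \ B) M).card *
          ((M.map multisetFactorial).prod * multisetFactorial M) =
          multisetFactorial (S.val.map c - t) := by
      intro B hB
      obtain ⟨hBS, hBt⟩ := Finset.mem_filter.1 hB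
      have : (S \ B).val.map c = S.val.map c - t := by
        refine eq_tsub_of_add_eq ?_
        rw [← hBt, ← Multiset.map_add, Finset.sdiff_val,
          tsub_add_cancel_of_le (Finset.val_le_iff.2 (Finset.mem_powerset.1 hBS))]
      rw [← this]
      refine ih _ h0 ?_
      rw [this, ← hS, add_tsub_cancel_left]
    rw [multisetFactorial_cons, Multiset.map_cons, Multiset.prod_cons]
    have hle : t ≤ S.val.map c := hS ▸ Multiset.le_add_right t M.sum
    calc _ = (collapsingPartitions c S (t ::ₘ M)).card * (M.count t + 1) *
            ((M.map multisetFactorial).prod * multisetFactorial M) * multisetFactorial t := by ring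
      _ = multisetFactorial (S.val.map c) := by
        rw [hrec, Finset.sum_mul, Finset.sum_congr rfl hsub, Finset.sum_const, smul_eq_mul,
          card_filter_powerset_map, ← count_powerset_mul_multisetFactorial _ t hle]
        ring

theorem Finpartition.sum_val_parts {α : Type*} [DecidableEq α] {S : Finset α}
    (π : Finpartition S) : ∑ B ∈ π.parts, B.val = S.val := by
  calc ∑ B ∈ π.parts, B.val = (π.parts.disjiUnion id π.disjoint).val := by
        rw [Finset.disjiUnion_val]; rfl
    _ = S.val := by rw [Finset.disjiUnion_eq_biUnion, π.biUnion_parts]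

theorem card_filter_collapsePartition {N n : ℕ} (c : Fin N → Fin n)
    {M : Multiset (Multiset (Fin n))} (h0 : 0 ∉ M) :
    (Finset.univ.filter fun π : Finpartition (Finset.univ : Finset (Fin N)) =>
      collapsePartition c π = M).card = (collapsingPartitions c Finset.univ M).card := by
  refine Finset.card_bij (fun π _ => π.parts) ?_ (fun _ _ _ _ => Finpartition.ext) ?_
  · intro π hπ
    exact mem_collapsingPartitions.2 ⟨π.sum_val_parts, (Finset.mem_filter.1 hπ).2⟩
  · intro P hP
    obtain ⟨h₁, h₂⟩ := mem_collapsingPartitions.1 hP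
    have hdisj : (P : Set (Finset (Fin N))).PairwiseDisjoint id := by
      intro B hB B' hB' hne
      have hle : B.val + B'.val ≤ Finset.univ.val := by
        rw [← h₁, ← Finset.add_sum_erase _ _ hB]
        exact add_le_add_right (Finset.single_le_sum (f := Finset.val)
          (fun _ _ => Multiset.zero_le _) (Finset.mem_erase.2 ⟨hne.symm, hB'⟩)) _
      have := (Multiset.nodup_add.1 (Multiset.nodup_of_le hle Finset.univ.nodup)).2.2
      exact Finset.disjoint_val.1 this
    refine ⟨⟨P, Finset.supIndep_iff_pairwiseDisjoint.2 hdisj, ?_, fun hbot => h0 ?_⟩,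
      Finset.mem_filter.2 ⟨Finset.mem_univ _, h₂⟩, rfl⟩
    · rw [Finset.sup_eq_biUnion, ← Finset.disjiUnion_eq_biUnion _ _ hdisj]
      refine Finset.val_injective ?_
      rw [← h₁, Finset.disjiUnion_val]
      rfl
    · rw [← h₂]
      exact Multiset.mem_map.2 ⟨⊥, hbot, rfl⟩

/-- The number of partitions of the set `{1, …, N}` that collapse, along the collapse
map `c`, to a given partition `m₁τ₁ + ⋯ + m_sτ_s` of the multiset `τ` (where the
`τᵢ` are pairwise distinct nonempty multisets occurring with multiplicities `mᵢ ≥ 1`)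
is `(k₁! ⋯ kₙ!) / (τ₁!!^{m₁} ⋯ τ_s!!^{m_s} · m₁! ⋯ m_s!)`. -/
theorem card_collapsing_partitions (n : ℕ) (hn : 0 < n)
    (k : Fin n → ℕ) (hk : ∀ i, 0 < k i) (N : ℕ) (hN : N = ∑ i, k i)
    (τ : Multiset (Fin n)) (hτ : τ = ∑ i, Multiset.replicate (k i) i)
    (c : Fin N → Fin n)
    (hc : ∀ i, (Finset.univ.filter fun a => c a = i).card = k i)
    (s : ℕ) (T : Fin s → Multiset (Fin n)) (hT : Function.Injective T)
    (hT0 : ∀ i, T i ≠ 0) (m : Fin s → ℕ) (hm : ∀ i, 1 ≤ m i)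
    (hsum : ∑ i, m i • T i = τ) :
    (Finset.univ.filter fun π : Finpartition (Finset.univ : Finset (Fin N)) =>
        collapsePartition c π = ∑ i, Multiset.replicate (m i) (T i)).card =
      (∏ i, (k i).factorial) /
        ((∏ i, multisetFactorial (T i) ^ m i) * ∏ i, (m i).factorial) := by
  have hcount : ∀ i, (∑ j, Multiset.replicate (m j) (T j)).count (T i) = m i := fun i => by
    simp [Multiset.count_sum', Multiset.count_replicate, hT.eq_iff]
  have h0 : (0 : Multiset (Fin n)) ∉ ∑ i, Multiset.replicate (m i) (T i) := by
    simp only [Multiset.mem_sum, Multiset.mem_replicate, not_exists, not_and]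
    exact fun i _ _ h => hT0 i h.symm
  have hkc : ∀ i, (Finset.univ.val.map c).count i = k i := fun i => by
    rw [Multiset.count_map, ← hc i, Finset.card_def, Finset.filter_val]
    simp only [eq_comm]
  have hs : (∑ i, Multiset.replicate (m i) (T i)).sum = Finset.univ.val.map c := by
    have : (∑ i, Multiset.replicate (m i) (T i)).sum = ∑ i, m i • T i := by
      rw [← Multiset.coe_sumAddMonoidHom, map_sum]
      simp
    rw [this, hsum, hτ]
    ext i
    rw [hkc]
    simp [Multiset.count_sum', Multiset.count_replicate]
  have hmap : ((∑ i, Multiset.replicate (m i) (T i)).map multisetFactorial).prod =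
      ∏ i, multisetFactorial (T i) ^ m i := by
    rw [← Multiset.coe_mapAddMonoidHom, map_sum, Multiset.prod_sum]
    simp
  have hM : multisetFactorial (∑ i, Multiset.replicate (m i) (T i)) = ∏ i, (m i).factorial := by
    rw [multisetFactorial_eq_prod (s := Finset.univ.image T), Finset.prod_image hT.injOn]
    · simp only [hcount]
    · intro t ht
      simp only [Multiset.mem_toFinset, Multiset.mem_sum, Multiset.mem_replicate] at ht
      obtain ⟨i, -, -, rfl⟩ := ht
      exact Finset.mem_image_of_mem T (Finset.mem_univ i)
  have hK : multisetFactorial (Finset.univ.val.map c) = ∏ i, (k i).factorial := by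
    simp only [multisetFactorial_eq_prod (Finset.subset_univ _), hkc]
  have key := card_collapsingPartitions_mul c _ Finset.univ h0 hs
  rw [hmap, hM, hK] at key
  rw [card_filter_collapsePartition c h0]
  refine (Nat.div_eq_of_eq_mul_left ?_ key.symm).symm
  exact Nat.mul_pos (Finset.prod_pos fun i _ => Nat.pow_pos (multisetFactorial_pos _))
    (Finset.prod_pos fun i _ => Nat.factorial_pos _)
end

section
/- Let k be a positive natural number and let f, y : ℝ → ℝ be infinitely differentiable. Then for every x, the k-th derivative of f ∘ y at x equals the sum, over all k-tuples (m₁, …, m_k) of non-negative integers satisfying m₁ + 2m₂ + ⋯ + k·m_k = k, of [k! / (1!^{m₁} ⋯ k!^{m_k} · m₁! ⋯ m_k!)] · f^(m₁+⋯+m_k)(y(x)) · ∏_{j : m_j ≠ 0} (y^(j)(x))^{m_j} (Faà di Bruno's formula). -/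
theorem succ_mul_le_weight {N : ℕ} (m : Fin N → ℕ) (l : Fin N) :
    ((l : ℕ) + 1) * m l ≤ ∑ j : Fin N, ((j : ℕ) + 1) * m j :=
  Finset.single_le_sum (f := fun j : Fin N => ((j : ℕ) + 1) * m j)
    (fun _ _ => Nat.zero_le _) (Finset.mem_univ l)

/-- Multiplicities `m` with total weight `∑ (j + 1) * m j` equal to `n`. -/
def multiplicities (N n : ℕ) : Finset (Fin N → ℕ) :=
  {m ∈ Fintype.piFinset fun _ => Finset.range (n + 1) | ∑ j : Fin N, ((j : ℕ) + 1) * m j = n}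

theorem mem_multiplicities {N n : ℕ} {m : Fin N → ℕ} :
    m ∈ multiplicities N n ↔ ∑ j : Fin N, ((j : ℕ) + 1) * m j = n := by
  simp only [multiplicities, Finset.mem_filter, Fintype.mem_piFinset, Finset.mem_range,
    and_iff_right_iff_imp]
  rintro rfl j
  exact Nat.lt_succ_of_le ((Nat.le_mul_of_pos_left _ (Nat.succ_pos _)).trans
    (succ_mul_le_weight m j))

/-- The normalized partial sums occurring in Faà di Bruno's formula, with `a i` in place of the
derivatives of the outer function and `b j` in place of the Taylor coefficients of the inner
one. -/
noncomputable def bellSum (N n : ℕ) (a b : ℕ → ℝ) : ℝ :=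
  ∑ m ∈ multiplicities N n, a (∑ j, m j) * ∏ j : Fin N, b j ^ m j / (m j).factorial

theorem bellSum_zero (N : ℕ) (a b : ℕ → ℝ) : bellSum N 0 a b = a 0 := by
  have : multiplicities N 0 = {0} := by
    ext m
    simp [mem_multiplicities, funext_iff]
  simp [bellSum, this]

theorem sum_add_single {N : ℕ} (c m : Fin N → ℕ) (l : Fin N) :
    ∑ j, c j * (m + Pi.single l 1 : Fin N → ℕ) j = ∑ j, c j * m j + c l := by
  simp [mul_add, Finset.sum_add_distrib, Pi.single_apply]

theorem prod_pow_div_factorial_add_single {N : ℕ} (b : ℕ → ℝ) (m : Fin N → ℕ) (l : Fin N) :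
    (m l + 1) * ∏ j : Fin N, b j ^ (m + Pi.single l 1 : Fin N → ℕ) j /
        ((m + Pi.single l 1 : Fin N → ℕ) j).factorial =
      b l * ∏ j : Fin N, b j ^ m j / (m j).factorial := by
  rw [← Finset.mul_prod_erase _ _ (Finset.mem_univ l),
    ← Finset.mul_prod_erase _ (fun j : Fin N => b j ^ m j / (m j).factorial) (Finset.mem_univ l),
    Finset.prod_congr rfl (fun j hj => ?_), ← mul_assoc, ← mul_assoc]
  · congr 1
    have := Nat.factorial_ne_zero (m l)
    simp only [Pi.add_apply, Pi.single_eq_same, Nat.factorial_succ]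
    push_cast
    field_simp
    ring
  · simp [Pi.single_eq_of_ne (Finset.ne_of_mem_erase hj)]

theorem sum_mul_bellSum_term (N n : ℕ) (a b : ℕ → ℝ) (l : Fin N) :
    ∑ m ∈ multiplicities N (n + (l + 1)),
        (m l : ℝ) * (a (∑ j, m j) * ∏ j : Fin N, b j ^ m j / (m j).factorial) =
      b l * bellSum N n (fun i => a (i + 1)) b := by
  rw [bellSum, Finset.mul_sum]
  symm
  refine Finset.sum_of_injOn (· + Pi.single l 1) (add_left_injective _).injOn (fun m hm => ?_)
    (fun m hm hne => ?_) (fun m _ => ?_)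
  · rw [Finset.mem_coe, mem_multiplicities] at hm ⊢
    rw [sum_add_single (fun j : Fin N => (j : ℕ) + 1), hm]
  · suffices m l = 0 by simp [this]
    by_contra hl
    have hm' : m - Pi.single l 1 + Pi.single l 1 = m := by
      ext j
      rcases eq_or_ne j l with rfl | h
      · simp [Nat.sub_add_cancel (Nat.one_le_iff_ne_zero.2 hl)]
      · simp [h]
    refine hne ⟨m - Pi.single l 1, ?_, hm'⟩
    rw [mem_multiplicities, ← hm', sum_add_single (fun j : Fin N => (j : ℕ) + 1)] at hm
    exact mem_multiplicities.2 (add_right_cancel hm)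
  · have hs : ∑ j, (m + Pi.single l 1 : Fin N → ℕ) j = ∑ j, m j + 1 := by
      simpa using sum_add_single 1 m l
    have hp := prod_pow_div_factorial_add_single b m l
    simp only [hs]
    rw [mul_left_comm, ← hp]
    simp only [Pi.add_apply, Pi.single_eq_same]
    push_cast
    ring

theorem succ_mul_bellSum_succ {N n : ℕ} (h : n + 1 ≤ N) (a b : ℕ → ℝ) :
    (n + 1) * bellSum N (n + 1) a b =
      ∑ i ∈ Finset.range (n + 1), (i + 1) * (b i * bellSum N (n - i) (fun i => a (i + 1)) b) := by
  have expand : (n + 1) * bellSum N (n + 1) a b = ∑ l : Fin N, ((l : ℕ) + 1 : ℝ) *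
      ∑ m ∈ multiplicities N (n + 1),
        (m l : ℝ) * (a (∑ j, m j) * ∏ j : Fin N, b j ^ m j / (m j).factorial) := by
    simp only [bellSum, Finset.mul_sum]
    rw [Finset.sum_comm]
    refine Finset.sum_congr rfl fun m hm => ?_
    have hw : ∑ j : Fin N, ((j : ℕ) + 1 : ℝ) * m j = n + 1 := by
      exact_mod_cast mem_multiplicities.1 hm
    simp only [← mul_assoc, ← Finset.sum_mul, hw]
  rw [expand, Finset.sum_range]
  symm
  refine Finset.sum_of_injOn (Fin.castLE h) (Fin.castLE_injective h).injOn (by simp)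
    (fun l _ hl => ?_) (fun i _ => ?_)
  · rw [Finset.sum_eq_zero, mul_zero]
    intro m hm
    have hnl : n < l := by
      by_contra hln
      exact hl ⟨⟨l, by omega⟩, by simp, by ext; rfl⟩
    have := (succ_mul_le_weight m l).trans_eq (mem_multiplicities.1 hm)
    have : m l = 0 := by
      by_contra hml
      have := Nat.le_mul_of_pos_right ((l : ℕ) + 1) (Nat.pos_of_ne_zero hml)
      omega
    simp [this]
  · have hi : n - i + (((Fin.castLE h i : Fin N) : ℕ) + 1) = n + 1 := by
      simp only [Fin.val_castLE]
      omega
    have := sum_mul_bellSum_term N (n - i) a b (Fin.castLE h i)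
    rw [hi] at this
    rw [this]
    simp

theorem iteratedDeriv_comp_eq_bellSum {N : ℕ} {y : ℝ → ℝ} (hy : ContDiff ℝ (⊤ : ℕ∞) y) (x : ℝ)
    {n : ℕ} (hn : n ≤ N) {f : ℝ → ℝ} (hf : ContDiff ℝ (⊤ : ℕ∞) f) :
    iteratedDeriv n (f ∘ y) x = n.factorial * bellSum N n (fun i => iteratedDeriv i f (y x))
      fun j => iteratedDeriv (j + 1) y x / (j + 1).factorial := by
  induction n using Nat.strong_induction_on generalizing f with
  | _ n ih =>
  cases n with
  | zero => simp [bellSum_zero]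
  | succ n =>
    have hf' : ContDiff ℝ (⊤ : ℕ∞) (deriv f) := (contDiff_infty_iff_deriv.1 hf).2
    have hy' : ContDiff ℝ (⊤ : ℕ∞) (deriv y) := (contDiff_infty_iff_deriv.1 hy).2
    have hderiv : deriv (f ∘ y) = deriv y * (deriv f ∘ y) := by
      ext t
      rw [deriv_comp t (hf.differentiable (by simp) _) (hy.differentiable (by simp) _), mul_comm]
      rfl
    have hle : ((n : ℕ) : WithTop ℕ∞) ≤ ((⊤ : ℕ∞) : WithTop ℕ∞) := by
      exact_mod_cast le_top
    rw [iteratedDeriv_succ', hderiv, iteratedDeriv_mul (hy'.of_le hle).contDiffAt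
      ((hf'.comp hy).of_le hle).contDiffAt, Nat.factorial_succ]
    push_cast
    rw [mul_comm ((n : ℝ) + 1), mul_assoc, succ_mul_bellSum_succ hn, Finset.mul_sum]
    refine Finset.sum_congr rfl fun i hi => ?_
    have hin : i ≤ n := Finset.mem_range_succ_iff.1 hi
    rw [ih (n - i) (by omega) (by omega) hf', ← iteratedDeriv_succ', Nat.cast_choose ℝ hin]
    simp only [← iteratedDeriv_succ', Nat.factorial_succ i]
    have := Nat.factorial_ne_zero i
    have := Nat.factorial_ne_zero (n - i)
    push_cast
    field_simp


/-- Faà di Bruno's formula: the `k`-th derivative of `f ∘ y` is the sum, over all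
`k`-tuples `(m₁, …, m_k)` of non-negative integers with `m₁ + 2m₂ + ⋯ + k·m_k = k`
(here `m j` stands for `m_{j+1}` for `j : Fin k`), of
`k! / (1!^{m₁} ⋯ k!^{m_k} · m₁! ⋯ m_k!) · f^(m₁+⋯+m_k)(y x) · ∏_{j : m_j ≠ 0} (y^(j)(x))^{m_j}`. -/
theorem faa_di_bruno (k : ℕ) (hk : 0 < k) (f y : ℝ → ℝ)
    (hf : ContDiff ℝ (⊤ : ℕ∞) f) (hy : ContDiff ℝ (⊤ : ℕ∞) y) (x : ℝ) :
    iteratedDeriv k (f ∘ y) x =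
      ∑ᶠ (m : Fin k → ℕ) (_ : ∑ j : Fin k, ((j : ℕ) + 1) * m j = k),
        ((k.factorial : ℝ) /
            ((∏ j : Fin k, (((j : ℕ) + 1).factorial : ℝ) ^ m j) *
              ∏ j, ((m j).factorial : ℝ))) *
          iteratedDeriv (∑ j, m j) f (y x) *
          ∏ j ∈ Finset.univ.filter fun j : Fin k => m j ≠ 0,
            (iteratedDeriv ((j : ℕ) + 1) y x) ^ m j := by
  rw [finsum_cond_eq_sum_of_cond_iff _ fun _ => mem_multiplicities.symm,
    iteratedDeriv_comp_eq_bellSum hy x le_rfl hf, bellSum, Finset.mul_sum]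
  refine Finset.sum_congr rfl fun m _ => ?_
  have hprod : ∏ j ∈ Finset.univ.filter fun j : Fin k => m j ≠ 0,
      (iteratedDeriv ((j : ℕ) + 1) y x) ^ m j = ∏ j : Fin k, iteratedDeriv ((j : ℕ) + 1) y x ^ m j :=
    Finset.prod_filter_of_ne fun j _ h hm => h (by simp [hm])
  rw [hprod]
  simp only [div_pow, Finset.prod_div_distrib, Finset.prod_mul_distrib, div_div]
  ring
end

section
/- Let k be a positive natural number and let f, y : ℝ → ℝ be infinitely differentiable. Then for every x, the k-th derivative of f ∘ y at x equals the sum, over all partitions π of the set {1, …, k}, of f^(|π|)(y(x)) times the product over the blocks B of π of y^(|B|)(x), where |π| is the number of blocks of π and |B| the size of block B (the set-partition form of Faà di Bruno's formula). -/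
namespace OrderedFinpartition

variable {n : ℕ}

/-- The `m`-th block of an ordered finpartition, as a finset. -/
def block (c : OrderedFinpartition n) (m : Fin c.length) : Finset (Fin n) :=
  Finset.univ.map ⟨c.emb m, (c.emb_strictMono m).injective⟩

/-- The greatest element of the `m`-th block of an ordered finpartition. -/
def blockMax (c : OrderedFinpartition n) (m : Fin c.length) : Fin n :=
  c.emb m ⟨c.partSize m - 1, Nat.sub_one_lt_of_lt (c.partSize_pos m)⟩

theorem mem_block {c : OrderedFinpartition n} {m : Fin c.length} {a : Fin n} :
    a ∈ c.block m ↔ a ∈ Set.range (c.emb m) := by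
  simp [block]

theorem coe_block (c : OrderedFinpartition n) (m : Fin c.length) :
    (c.block m : Set (Fin n)) = Set.range (c.emb m) :=
  Set.ext fun _ ↦ mem_block

theorem card_block (c : OrderedFinpartition n) (m : Fin c.length) :
    (c.block m).card = c.partSize m := by
  simp [block]

theorem isGreatest_blockMax (c : OrderedFinpartition n) (m : Fin c.length) :
    IsGreatest (c.block m : Set (Fin n)) (c.blockMax m) := by
  rw [coe_block]
  refine ⟨⟨_, rfl⟩, ?_⟩
  rintro _ ⟨j, rfl⟩
  exact (c.emb_strictMono m).monotone (Fin.le_def.2 (Nat.le_sub_one_of_lt j.2))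

theorem eq_of_mem_block {c : OrderedFinpartition n} {i j : Fin c.length} {a : Fin n}
    (hi : a ∈ c.block i) (hj : a ∈ c.block j) : i = j := by
  by_contra h
  exact Set.disjoint_left.1 (c.disjoint (Set.mem_univ i) (Set.mem_univ j) h)
    (mem_block.1 hi) (mem_block.1 hj)

theorem block_injective (c : OrderedFinpartition n) : Function.Injective c.block := by
  intro i j h
  have hi : c.blockMax i ∈ c.block i := (c.isGreatest_blockMax i).1
  exact eq_of_mem_block hi (h ▸ hi)

/-- The unordered partition underlying an ordered finpartition. -/
def toFinpartition (c : OrderedFinpartition n) :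
    Finpartition (Finset.univ : Finset (Fin n)) :=
  Finpartition.ofExistsUnique (Finset.univ.map ⟨c.block, c.block_injective⟩)
    (fun _ _ ↦ Finset.subset_univ _)
    (by
      intro a _
      obtain ⟨m, hm⟩ := c.cover a
      refine ⟨c.block m, ⟨by simp, mem_block.2 hm⟩, ?_⟩
      rintro B ⟨hB, ha⟩
      obtain ⟨j, -, rfl⟩ := Finset.mem_map.1 hB
      exact congrArg c.block (eq_of_mem_block ha (mem_block.2 hm)))
    (by
      intro h
      obtain ⟨j, -, hj⟩ := Finset.mem_map.1 h
      exact Finset.ne_empty_of_mem (c.isGreatest_blockMax j).1 hj)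

theorem toFinpartition_parts (c : OrderedFinpartition n) :
    c.toFinpartition.parts = Finset.univ.map ⟨c.block, c.block_injective⟩ := rfl

theorem mem_toFinpartition_parts {c : OrderedFinpartition n} {B : Finset (Fin n)} :
    B ∈ c.toFinpartition.parts ↔ ∃ m, c.block m = B := by
  simp [toFinpartition_parts]

theorem mem_range_blockMax {c : OrderedFinpartition n} {a : Fin n} :
    a ∈ Set.range c.blockMax ↔
      ∃ B ∈ c.toFinpartition.parts, IsGreatest (B : Set (Fin n)) a := by
  constructor
  · rintro ⟨m, rfl⟩
    exact ⟨_, mem_toFinpartition_parts.2 ⟨m, rfl⟩, c.isGreatest_blockMax m⟩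
  · rintro ⟨B, hB, ha⟩
    obtain ⟨m, rfl⟩ := mem_toFinpartition_parts.1 hB
    exact ⟨m, (c.isGreatest_blockMax m).unique ha⟩

/-- Two ordered finpartitions with the same blocks in the same order are equal. -/
theorem eq_of_block_eq {c d : OrderedFinpartition n} (hl : c.length = d.length)
    (hb : ∀ m, c.block m = d.block (Fin.cast hl m)) : c = d := by
  have hs (m) : c.partSize m = d.partSize (Fin.cast hl m) := by
    rw [← card_block, ← card_block, hb]
  have hr (m) : Set.range (c.emb m) = Set.range (d.emb (Fin.cast hl m)) := by
    rw [← coe_block, ← coe_block, hb]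
  obtain ⟨l, s, _, e, he, _, _, _⟩ := c
  obtain ⟨l', s', _, e', he', _, _, _⟩ := d
  dsimp only at hl
  subst hl
  obtain rfl : s = s' := funext hs
  obtain rfl : e = e' := funext fun m ↦ ((he m).range_inj (he' m)).1 (hr m)
  rfl

theorem toFinpartition_injective :
    Function.Injective (toFinpartition : OrderedFinpartition n → _) := by
  intro c d h
  have hl : c.length = d.length := by
    simpa [toFinpartition_parts] using congrArg (fun π ↦ π.parts.card) h
  have hd : StrictMono fun m ↦ d.blockMax (Fin.cast hl m) :=
    d.parts_strictMono.comp (Fin.cast_strictMono hl)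
  have hmax : c.blockMax = fun m ↦ d.blockMax (Fin.cast hl m) := by
    refine (StrictMono.range_inj c.parts_strictMono hd).1 ?_
    have hsurj : Function.Surjective (Fin.cast hl) := (finCongr hl).surjective
    rw [show (fun m ↦ d.blockMax (Fin.cast hl m)) = d.blockMax ∘ Fin.cast hl from rfl,
      hsurj.range_comp]
    ext a
    exact mem_range_blockMax.trans (h ▸ mem_range_blockMax.symm)
  refine eq_of_block_eq hl fun m ↦ ?_
  refine d.toFinpartition.eq_of_mem_parts (a := c.blockMax m)
    (h ▸ mem_toFinpartition_parts.2 ⟨m, rfl⟩) (mem_toFinpartition_parts.2 ⟨_, rfl⟩)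
    (c.isGreatest_blockMax m).1 ?_
  rw [hmax]
  exact (d.isGreatest_blockMax _).1

/-- The blocks of a partition of `Fin n`, listed by increasing greatest element. -/
theorem exists_enumeration_parts (π : Finpartition (Finset.univ : Finset (Fin n))) :
    ∃ (l : ℕ) (B : Fin l → Finset (Fin n)) (t : Fin l → Fin n), StrictMono t ∧
      (∀ m, IsGreatest (B m : Set (Fin n)) (t m)) ∧ ∀ A, A ∈ π.parts ↔ ∃ m, B m = A := by
  classical
  let M : Finset (Fin n) :=
    Finset.univ.filter fun a ↦ IsGreatest (π.part a : Set (Fin n)) a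
  have hM (a : Fin n) : a ∈ M ↔ IsGreatest (π.part a : Set (Fin n)) a := by simp [M]
  refine ⟨M.card, fun m ↦ π.part (M.orderEmbOfFin rfl m), M.orderEmbOfFin rfl,
    (M.orderEmbOfFin rfl).strictMono,
    fun m ↦ (hM _).1 (M.orderEmbOfFin_mem rfl m), fun A ↦ ⟨fun hA ↦ ?_, ?_⟩⟩
  · have hne := π.nonempty_of_mem_parts hA
    have hpart : π.part (A.max' hne) = A := π.part_eq_of_mem hA (A.max'_mem hne)
    have hmem : A.max' hne ∈ M := by
      rw [hM, hpart]
      exact A.isGreatest_max' hne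
    obtain ⟨m, hm⟩ : A.max' hne ∈ Set.range (M.orderEmbOfFin rfl) := by
      rw [M.range_orderEmbOfFin rfl]; exact hmem
    exact ⟨m, (congrArg π.part hm).trans hpart⟩
  · rintro ⟨m, rfl⟩
    exact π.part_mem.2 (Finset.mem_univ _)

theorem toFinpartition_surjective :
    Function.Surjective (toFinpartition : OrderedFinpartition n → _) := by
  intro π
  obtain ⟨l, B, t, ht, hB, hπ⟩ := exists_enumeration_parts π
  have hpos (m) : 0 < (B m).card := Finset.card_pos.2 ⟨t m, (hB m).1⟩
  have hlast (m) : (B m).orderEmbOfFin rfl ⟨(B m).card - 1, Nat.sub_one_lt_of_lt (hpos m)⟩ =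
      t m := by
    rw [Finset.orderEmbOfFin_last rfl (hpos m)]
    exact ((B m).isGreatest_max' _).unique (hB m)
  let c : OrderedFinpartition n :=
    { length := l
      partSize := fun m ↦ (B m).card
      partSize_pos := hpos
      emb := fun m ↦ (B m).orderEmbOfFin rfl
      emb_strictMono := fun m ↦ ((B m).orderEmbOfFin rfl).strictMono
      parts_strictMono := by simpa only [hlast] using ht
      disjoint := by
        intro i _ j _ hij
        simp only [Function.onFun, Finset.range_orderEmbOfFin]
        refine Set.disjoint_left.2 fun a hi hj ↦ hij (ht.injective ?_)
        have h := π.eq_of_mem_parts ((hπ _).2 ⟨i, rfl⟩) ((hπ _).2 ⟨j, rfl⟩) hi hj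
        exact (hB i).unique (h ▸ hB j)
      cover := by
        intro a
        obtain ⟨A, hA, ha⟩ := π.exists_mem (Finset.mem_univ a)
        obtain ⟨m, rfl⟩ := (hπ A).1 hA
        exact ⟨m, by rw [Finset.range_orderEmbOfFin]; exact ha⟩ }
  have hc (m) : c.block m = B m :=
    Finset.coe_injective ((c.coe_block m).trans ((B m).range_orderEmbOfFin rfl))
  refine ⟨c, Finpartition.ext (Finset.ext fun A ↦ ?_)⟩
  rw [mem_toFinpartition_parts, hπ]
  exact exists_congr fun m ↦ by rw [hc]

end OrderedFinpartition

/-- The set-partition form of Faà di Bruno's formula for one-variable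
infinitely differentiable functions. -/
theorem faa_di_bruno_set_partition (k : ℕ) (hk : 0 < k) (f y : ℝ → ℝ)
    (hf : ContDiff ℝ (⊤ : ℕ∞) f) (hy : ContDiff ℝ (⊤ : ℕ∞) y) (x : ℝ) :
    iteratedDeriv k (f ∘ y) x =
      ∑ π : Finpartition (Finset.univ : Finset (Fin k)),
        iteratedDeriv π.parts.card f (y x) *
          ∏ B ∈ π.parts, iteratedDeriv B.card y x := by
  rw [iteratedDeriv_comp_eq_sum_orderedFinpartition hf.contDiffAt hy.contDiffAt
    (mod_cast le_top)]
  refine Fintype.sum_bijective OrderedFinpartition.toFinpartition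
    ⟨OrderedFinpartition.toFinpartition_injective,
      OrderedFinpartition.toFinpartition_surjective⟩ _ _ fun c ↦ ?_
  simp [OrderedFinpartition.toFinpartition_parts, OrderedFinpartition.card_block]
end

section
/- Let k be a positive natural number. Then the sum, over all k-tuples (m₁, …, m_k) of non-negative integers satisfying m₁ + 2m₂ + ⋯ + k·m_k = k, of the Faà di Bruno coefficients k! / (1!^{m₁} · 2!^{m₂} ⋯ k!^{m_k} · m₁! ⋯ m_k!) equals the Bell number B_k. -/
namespace Finpartition

variable {α : Type*} [DecidableEq α] {a : α} {s : Finset α}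

/-- Adjoin the block `insert a t` to a partition of `s \ t`. -/
def insertBlock (ha : a ∉ s) (x : Σ t : s.powerset, Finpartition (s \ (t : Finset α))) :
    Finpartition (insert a s) :=
  x.2.extend (b := insert a (x.1 : Finset α)) (Finset.insert_ne_empty _ _)
    (by
      rw [Finset.disjoint_insert_right]
      exact ⟨fun h ↦ ha (Finset.mem_sdiff.1 h).1, Finset.sdiff_disjoint⟩)
    (by
      have := Finset.mem_powerset.1 x.1.2
      rw [Finset.sup_eq_union, Finset.union_insert, Finset.sdiff_union_of_subset this])

theorem notMem_of_mem_parts {u v : Finset α} (P : Finpartition u) (ha : a ∉ u)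
    (hv : v ∈ P.parts) : a ∉ v :=
  fun h ↦ ha (P.le hv h)

theorem insertBlock_injective (ha : a ∉ s) : Function.Injective (insertBlock ha) := by
  rintro ⟨⟨t, ht⟩, P⟩ ⟨⟨t', ht'⟩, P'⟩ h
  have hparts : insert (insert a t) P.parts = insert (insert a t') P'.parts :=
    congrArg Finpartition.parts h
  have hnot (u : Finset α) : a ∉ s \ u := fun h ↦ ha (Finset.mem_sdiff.1 h).1
  have hblock (u v : Finset α) (Q : Finpartition (s \ u)) : insert a v ∉ Q.parts :=
    fun h ↦ Q.notMem_of_mem_parts (hnot u) h (Finset.mem_insert_self a v)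
  have hmem : insert a t ∈ insert (insert a t') P'.parts :=
    hparts ▸ Finset.mem_insert_self _ _
  obtain rfl : t = t' := by
    have heq := (Finset.mem_insert.1 hmem).resolve_right (hblock t' t P')
    rw [← Finset.erase_insert fun h ↦ ha (Finset.mem_powerset.1 ht h), heq,
      Finset.erase_insert fun h ↦ ha (Finset.mem_powerset.1 ht' h)]
  obtain rfl : P = P' := by
    ext1
    rw [← Finset.erase_insert (hblock t t P), hparts, Finset.erase_insert (hblock t t P')]
  rfl

theorem insertBlock_surjective (ha : a ∉ s) : Function.Surjective (insertBlock ha) := by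
  intro P
  have haP : a ∈ P.part a := P.mem_part (Finset.mem_insert_self a s)
  have hpart : P.part a ∈ P.parts := P.part_mem.2 (Finset.mem_insert_self a s)
  have hsup : (P.parts.erase (P.part a)).sup id = s \ (P.part a).erase a := by
    ext x
    simp only [Finset.mem_sup, Finset.mem_erase, id, Finset.mem_sdiff]
    constructor
    · rintro ⟨v, ⟨hne, hv⟩, hx⟩
      have hxa : x ∉ P.part a := fun h ↦
        hne ((P.part_eq_of_mem hv hx).symm.trans (P.part_eq_of_mem hpart h))
      have hxs := P.le hv hx
      grind
    · rintro ⟨hxs, hx⟩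
      have hxi : x ∈ insert a s := Finset.mem_insert_of_mem hxs
      refine ⟨P.part x, ⟨fun h ↦ hx ⟨?_, h ▸ P.mem_part hxi⟩, P.part_mem.2 hxi⟩, P.mem_part hxi⟩
      rintro rfl
      exact ha hxs
  refine ⟨⟨⟨(P.part a).erase a, ?_⟩, ⟨P.parts.erase (P.part a),
    P.supIndep.subset (Finset.erase_subset _ _), hsup,
    fun h ↦ P.bot_notMem (Finset.mem_of_mem_erase h)⟩⟩, ?_⟩
  · have := P.part_subset a
    grind
  · ext1
    change insert (insert a ((P.part a).erase a)) (P.parts.erase (P.part a)) = P.parts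
    rw [Finset.insert_erase haP, Finset.insert_erase hpart]

/-- The number of partitions of a finite set is the Bell number of its cardinality. -/
theorem card_eq_bell (s : Finset α) : Fintype.card (Finpartition s) = s.card.bell := by
  induction s using Finset.strongInduction with
  | H s ih =>
    obtain rfl | ⟨a, ha⟩ := s.eq_empty_or_nonempty
    · rw [Finset.card_empty, Nat.bell_zero]
      exact Fintype.card_unique (α := Finpartition (⊥ : Finset α))
    obtain ⟨s, has, rfl⟩ : ∃ r, a ∉ r ∧ insert a r = s :=
      ⟨s.erase a, Finset.notMem_erase a s, Finset.insert_erase ha⟩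
    rw [← Fintype.card_of_bijective ⟨insertBlock_injective has, insertBlock_surjective has⟩,
      Fintype.card_sigma, Finset.card_insert_of_notMem has, Nat.bell_succ,
      ← Nat.range_succ_eq_Iic]
    calc
      _ = ∑ t : s.powerset, (s.card - (t : Finset α).card).bell := by
        refine Fintype.sum_congr _ _ fun t ↦ ?_
        rw [ih _ (Finset.ssubset_of_subset_of_ssubset Finset.sdiff_subset
          (Finset.ssubset_insert has)), Finset.card_sdiff_of_subset (Finset.mem_powerset.1 t.2)]
      _ = ∑ t ∈ s.powerset, (s.card - t.card).bell :=
        s.powerset.sum_coe_sort fun t ↦ (s.card - t.card).bell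
      _ = _ := by
        simpa using Finset.sum_powerset_apply_card (fun i ↦ (s.card - i).bell) (x := s)

end Finpartition

namespace Nat.Partition

variable {k : ℕ}

/-- The multiplicities of the parts `1, …, k` of a partition of `k`. -/
def multiplicity (p : k.Partition) (j : Fin k) : ℕ := p.parts.count ((j : ℕ) + 1)

@[to_additive]
theorem prod_toFinset_eq_prod_fin {M : Type*} [CommMonoid M] (p : k.Partition) (f : ℕ → M)
    (hf : ∀ i, i ∉ p.parts → f i = 1) :
    ∏ i ∈ p.parts.toFinset, f i = ∏ j : Fin k, f ((j : ℕ) + 1) := by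
  rw [Fin.prod_univ_eq_prod_range (fun i ↦ f (i + 1)) k, Finset.range_eq_Ico,
    Finset.prod_Ico_add' f 0 k 1]
  refine Finset.prod_subset (fun i hi ↦ ?_) fun i _ hi ↦ hf i (by simpa using hi)
  have hi' := Multiset.mem_toFinset.1 hi
  have := p.parts_pos hi'
  have := p.le_of_mem_parts hi'
  simp only [Finset.mem_Ico]
  lia

theorem sum_mul_multiplicity (p : k.Partition) :
    ∑ j : Fin k, ((j : ℕ) + 1) * p.multiplicity j = k := by
  unfold multiplicity
  rw [← p.sum_toFinset_eq_sum_fin (fun i ↦ i * p.parts.count i)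
    fun i hi ↦ by simp [Multiset.count_eq_zero_of_notMem hi]]
  conv_rhs => rw [← p.parts_sum, Finset.sum_multiset_count]
  simp [mul_comm]

theorem bell_parts_eq_div (p : k.Partition) :
    p.parts.bell = k.factorial / ((∏ j : Fin k, ((j : ℕ) + 1).factorial ^ p.multiplicity j) *
      ∏ j : Fin k, (p.multiplicity j).factorial) := by
  have h0 : 0 ∉ p.parts.toFinset := fun h ↦ (p.parts_pos (Multiset.mem_toFinset.1 h)).ne rfl
  unfold multiplicity
  rw [Multiset.bell_eq, p.parts_sum, Finset.erase_eq_of_notMem h0,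
    Finset.prod_multiset_map_count,
    p.prod_toFinset_eq_prod_fin (fun i ↦ i.factorial ^ p.parts.count i)
      fun i hi ↦ by simp [Multiset.count_eq_zero_of_notMem hi],
    p.prod_toFinset_eq_prod_fin (fun i ↦ (p.parts.count i).factorial)
      fun i hi ↦ by simp [Multiset.count_eq_zero_of_notMem hi]]

theorem multiplicity_injective : Function.Injective (multiplicity (k := k)) := by
  intro p q h
  ext i
  have hzero (r : k.Partition) (hi : ¬ (0 < i ∧ i ≤ k)) : r.parts.count i = 0 :=
    Multiset.count_eq_zero_of_notMem fun hr ↦ hi ⟨r.parts_pos hr, r.le_of_mem_parts hr⟩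
  by_cases hi : 0 < i ∧ i ≤ k
  · have := congrFun h ⟨i - 1, by lia⟩
    simpa [multiplicity, Nat.sub_add_cancel hi.1] using this
  · rw [hzero p hi, hzero q hi]

theorem exists_multiplicity_eq (m : Fin k → ℕ) (hm : ∑ j : Fin k, ((j : ℕ) + 1) * m j = k) :
    ∃ p : k.Partition, p.multiplicity = m := by
  refine ⟨⟨∑ j : Fin k, Multiset.replicate (m j) ((j : ℕ) + 1), fun {i} hi ↦ ?_, ?_⟩, ?_⟩
  · obtain ⟨j, -, hj⟩ := Multiset.mem_sum.1 hi
    rw [Multiset.eq_of_mem_replicate hj]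
    exact Nat.succ_pos _
  · refine Eq.trans ?_ hm
    simp [Multiset.sum_sum, mul_comm]
  · ext j
    simp [multiplicity, Multiset.count_sum', Multiset.count_replicate, Fin.val_inj]

theorem bijOn_multiplicity :
    Set.BijOn (multiplicity (k := k)) Set.univ {m | ∑ j : Fin k, ((j : ℕ) + 1) * m j = k} :=
  ⟨fun p _ ↦ p.sum_mul_multiplicity, multiplicity_injective.injOn, fun m hm ↦ by
    simpa using exists_multiplicity_eq m hm⟩

end Nat.Partition

/-- The sum over all `k`-tuples `(m₁, …, m_k)` of non-negative integers with
`m₁ + 2m₂ + ⋯ + k·m_k = k` (here `m j` stands for `m_{j+1}` for `j : Fin k`) of the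
Faà di Bruno coefficients `k! / (1!^{m₁} ⋯ k!^{m_k} · m₁! ⋯ m_k!)` equals the Bell
number `B_k`, the number of partitions of a set of size `k`. -/
theorem sum_faa_di_bruno_coefficients_eq_bell (k : ℕ) (hk : 0 < k) :
    ∑ᶠ (m : Fin k → ℕ) (_ : ∑ j : Fin k, ((j : ℕ) + 1) * m j = k),
        k.factorial /
          ((∏ j : Fin k, ((j : ℕ) + 1).factorial ^ m j) * ∏ j : Fin k, (m j).factorial) =
      Fintype.card (Finpartition (Finset.univ : Finset (Fin k))) := by
  rw [Finpartition.card_eq_bell, Finset.card_univ, Fintype.card_fin, Nat.bell_eq_sum_partition,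
    ← finsum_eq_sum_of_fintype, ← finsum_mem_univ fun p : k.Partition ↦ p.parts.bell]
  exact (finsum_mem_eq_of_bijOn _ Nat.Partition.bijOn_multiplicity
    fun p _ ↦ p.bell_parts_eq_div).symm
end
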